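/- arXiv:0905.1351 — 2 statements merged into one kernel-verified Lean document; each statement's English description precedes it below -/
import Mathlib

section
/- Let Ψ be a polynomial with algebraic coefficients, a > 0 algebraic, and suppose F(z) = ∫₀ᵃ e^{izt} Ψ(t) dt satisfies F(z₀) = 0 for some nonzero algebraic z₀. Writing F(z) = P(z)cos(az) + Q(z)sin(az) + R(z) with P,Q,R rational functions with algebraic coefficients, and setting t₀ = tan(az₀/2), then P(z₀)(1-t₀²) + 2Q(z₀)t₀ + R(z₀)(1+t₀²) = 0, so t₀ is algebraic (provided not all of P(z₀), Q(z₀), R(z₀) vanish), contradicting the transcendence of tan of a nonzero algebraic number; hence F has no nonzero algebraic zeroes unless P(z₀)=Q(z₀)=R(z₀)=0. -/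
open MeasureTheory Complex intervalIntegral

open Polynomial in
/-- Finitely many nonzero algebraic elements are common roots of an integer polynomial with
nonzero constant term. -/
theorem exists_int_polynomial_eval_zero_ne_zero {K : Type*} [Field K] [CharZero K]
    (S : Finset K) (hS : ∀ v ∈ S, IsAlgebraic ℤ v) (h0 : (0 : K) ∉ S) :
    ∃ f : ℤ[X], f.eval 0 ≠ 0 ∧ ∀ v ∈ S, aeval v f = 0 := by
  have h : ∀ v ∈ S, ∃ q : ℤ[X], q.coeff 0 ≠ 0 ∧ aeval v q = 0 := fun v hv ↦
    (hS v hv).exists_nonzero_coeff_and_aeval_eq_zero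
      (mem_nonZeroDivisors_of_ne_zero fun hv0 ↦ h0 (hv0 ▸ hv))
  choose! q hq0 hq using h
  refine ⟨∏ v ∈ S, q v, ?_, fun v hv ↦ ?_⟩
  · rw [eval_prod, Finset.prod_ne_zero_iff]
    intro v hv
    rw [← coeff_zero_eq_eval_zero]
    exact hq0 v hv
  · rw [map_prod]
    exact Finset.prod_eq_zero hv (hq v hv)

open Polynomial in
theorem isIntegral_pow_mul_aeval {K : Type*} [CommRing K] {b : ℤ} {v : K}
    (hb : IsIntegral ℤ (b * v : K)) {g : ℤ[X]} {N : ℕ} (hg : g.natDegree ≤ N) :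
    IsIntegral ℤ ((b : K) ^ N * aeval v g) := by
  rw [aeval_eq_sum_range, Finset.mul_sum]
  refine IsIntegral.sum _ fun i hi ↦ ?_
  have hi : i ≤ N := (Finset.mem_range_succ_iff.mp hi).trans hg
  have : (b : K) ^ N * g.coeff i • v ^ i = ((b ^ (N - i) * g.coeff i : ℤ) : K) * (b * v) ^ i := by
    rw [← Nat.sub_add_cancel hi, pow_add, Nat.add_sub_cancel]
    push_cast [zsmul_eq_mul]
    ring
  rw [this]
  exact (isIntegral_algebraMap (R := ℤ) (A := K)).mul (hb.pow i)

theorem exists_int_eq_of_isIntegral_of_fixed {K : Type*} [Field K] [NumberField K] [IsGalois ℚ K]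
    {x : K} (hx : IsIntegral ℤ x) (hfix : ∀ σ : K ≃ₐ[ℚ] K, σ x = x) : ∃ m : ℤ, (m : K) = x := by
  obtain ⟨q, rfl⟩ := (IsGalois.mem_range_algebraMap_iff_fixed x).mpr hfix
  rw [isIntegral_algebraMap_iff (algebraMap ℚ K).injective,
    IsIntegrallyClosed.isIntegral_iff] at hx
  obtain ⟨m, rfl⟩ := hx
  exact ⟨m, by simp⟩

open Filter Topology Nat in
theorem tendsto_pow_div_factorial_pred (C c : ℝ) :
    Tendsto (fun p : ℕ ↦ C * (c ^ p / (p - 1)!)) atTop (𝓝 0) := by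
  rw [← tendsto_add_atTop_iff_nat 1]
  have := (FloorSemiring.tendsto_pow_div_factorial_atTop c).const_mul (C * c)
  rw [mul_zero] at this
  refine this.congr fun p ↦ ?_
  rw [Nat.add_sub_cancel, pow_succ]
  ring

open Polynomial Filter in
/-- A Galois-invariant integer combination of exponentials of elements of a number field does not
vanish if the coefficient of `exp 0` does not. -/
theorem sum_mul_exp_ne_zero_of_invariant {K : Type*} [Field K] [NumberField K] [IsGalois ℚ K]
    (φ : K →+* ℂ) (z : K →₀ ℤ) (hz : ∀ (σ : K ≃ₐ[ℚ] K) v, z (σ v) = z v) (h0 : z 0 ≠ 0) :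
    z.sum (fun v m ↦ (m : ℂ) * exp (φ v)) ≠ 0 := by
  classical
  intro hsum
  set S := z.support.erase 0 with hS
  have hsplit {M : Type} [AddCommMonoid M] (F : K → M) :
      ∑ v ∈ z.support, F v = F 0 + ∑ v ∈ S, F v :=
    (Finset.add_sum_erase _ _ (Finsupp.mem_support_iff.mpr h0)).symm
  have halg (v : K) : IsAlgebraic ℤ v :=
    (IsFractionRing.isAlgebraic_iff ℤ ℚ K).mpr (Algebra.IsAlgebraic.isAlgebraic v)
  obtain ⟨f, hf0, hf⟩ := exists_int_polynomial_eval_zero_ne_zero S (fun v _ ↦ halg v) (by simp [S])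
  obtain ⟨b, hb0, hb⟩ := exists_integral_multiples ℤ ℚ S
  simp only [zsmul_eq_mul] at hb
  obtain ⟨c, hc⟩ := LindemannWeierstrass.exp_polynomial_approx f hf0
  set d := f.natDegree
  set C : ℝ := ∑ v ∈ S, |(z v : ℝ)|
  have hlim := tendsto_pow_div_factorial_pred C (|(b : ℝ)| ^ d * c)
  obtain ⟨p, hp, hp1, hpbig⟩ := ((Nat.frequently_atTop_iff_infinite.mpr
    Nat.infinite_setOfPred_prime).and_eventually ((hlim.eventually_lt_const one_pos).and
      (eventually_gt_atTop ((f.eval 0).natAbs + (z 0).natAbs + b.natAbs)))).exists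
  obtain ⟨n, hn, g, hgdeg, hg⟩ := hc p (by omega) hp
  set T : K := ∑ v ∈ S, (z v : K) * aeval v g
  have hTint : IsIntegral ℤ ((b : K) ^ (p * d) * T) := by
    rw [Finset.mul_sum]
    refine IsIntegral.sum _ fun v hv ↦ ?_
    rw [mul_left_comm]
    exact (isIntegral_algebraMap (R := ℤ) (A := K)).mul
      (isIntegral_pow_mul_aeval (hb v hv) (hgdeg.trans (Nat.sub_le _ _)))
  have hTfix (σ : K ≃ₐ[ℚ] K) : σ ((b : K) ^ (p * d) * T) = (b : K) ^ (p * d) * T := by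
    rw [map_mul, map_pow, map_intCast, map_sum]
    congr 1
    refine Finset.sum_equiv σ.toEquiv (fun v ↦ ?_) fun v _ ↦ ?_
    · simp [S, hz]
    · have : σ (aeval v g) = aeval (σ v) g :=
        (aeval_algHom_apply (σ : K →ₐ[ℚ] K).toIntAlgHom v g).symm
      simp [hz, this]
  obtain ⟨m, hm⟩ := exists_int_eq_of_isIntegral_of_fixed hTint hTfix
  have hbound : ‖((n * z 0 * b ^ (p * d) + p * m : ℤ) : ℂ)‖ < 1 := by
    have hzero : (z 0 : ℂ) = -∑ v ∈ S, (z v : ℂ) * exp (φ v) := by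
      rw [Finsupp.sum, hsplit] at hsum
      simpa using eq_neg_of_add_eq_zero_left hsum
    have hm' : (m : ℂ) = (b : ℂ) ^ (p * d) * ∑ v ∈ S, (z v : ℂ) * aeval (φ v) g := by
      rw [← map_intCast φ, hm, map_mul, map_pow, map_intCast, map_sum]
      refine congrArg _ (Finset.sum_congr rfl fun v _ ↦ ?_)
      rw [map_mul, map_intCast]
      exact congrArg _ (aeval_algHom_apply φ.toIntAlgHom v g).symm
    have heq : ((n * z 0 * b ^ (p * d) + p * m : ℤ) : ℂ) =
        -((b : ℂ) ^ (p * d) * ∑ v ∈ S, (z v : ℂ) * (n • exp (φ v) - p • aeval (φ v) g)) := by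
      push_cast
      rw [hzero, hm']
      simp only [zsmul_eq_mul, nsmul_eq_mul, mul_sub, Finset.sum_sub_distrib,
        mul_left_comm (z _ : ℂ),
        ← Finset.mul_sum]
      ring
    rw [heq, norm_neg, norm_mul, norm_pow, norm_intCast]
    refine lt_of_le_of_lt ?_ hp1
    calc _ ≤ |(b : ℝ)| ^ (p * d) * ∑ v ∈ S, |(z v : ℝ)| * (c ^ p / (p - 1).factorial) := by
          gcongr
          refine (norm_sum_le _ _).trans (Finset.sum_le_sum fun v hv ↦ ?_)
          rw [norm_mul, norm_intCast]
          gcongr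
          refine hg ((mem_aroots).mpr ⟨fun h ↦ hf0 (by simp [h]), ?_⟩)
          have := aeval_algHom_apply φ.toIntAlgHom v f
          rw [hf v hv, map_zero] at this
          exact this
      _ = _ := by
          rw [← Finset.sum_mul, mul_pow, ← pow_mul, mul_comm p d]
          ring
  rw [norm_intCast] at hbound
  have hzero : n * z 0 * b ^ (p * d) + p * m = 0 := Int.abs_lt_one_iff.mp (by exact_mod_cast hbound)
  have hpZ : Prime (p : ℤ) := Nat.prime_iff_prime_int.mp hp
  have hsmall {k : ℤ} (hk : k ≠ 0) (hkp : k.natAbs < p) : ¬ (p : ℤ) ∣ k := fun h ↦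
    hkp.not_ge (Nat.le_of_dvd (Int.natAbs_pos.mpr hk) (Int.natCast_dvd.mp h))
  have hdvd : (p : ℤ) ∣ n * z 0 * b ^ (p * d) := ⟨-m, by linarith⟩
  rcases hpZ.dvd_or_dvd hdvd with h | h
  · exact (hpZ.dvd_or_dvd h).elim hn (hsmall h0 (by omega))
  · exact hsmall hb0 (by omega) (hpZ.dvd_of_dvd_pow h)

/-- The algebra homomorphism from the group algebra `ℤ[K]` to `ℂ` sending the basis vector of `v` to
`exp (φ v)`. -/
noncomputable def expAlgHom {K : Type*} [Field K] (φ : K →+* ℂ) : AddMonoidAlgebra ℤ K →ₐ[ℤ] ℂ :=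
  AddMonoidAlgebra.lift ℤ ℂ K
    (Complex.expMonoidHom.comp (AddMonoidHom.toMultiplicative φ.toAddMonoidHom))

theorem expAlgHom_single {K : Type*} [Field K] (φ : K →+* ℂ) (v : K) (m : ℤ) :
    expAlgHom φ (AddMonoidAlgebra.single v m) = m * exp (φ v) := by
  simp [expAlgHom]

theorem expAlgHom_apply {K : Type*} [Field K] (φ : K →+* ℂ) (x : AddMonoidAlgebra ℤ K) :
    expAlgHom φ x = x.coeff.sum fun v m ↦ (m : ℂ) * exp (φ v) := by
  rw [expAlgHom, AddMonoidAlgebra.lift_apply]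
  simp

/-- The action of a Galois automorphism on the group algebra of the field. -/
noncomputable abbrev galoisMap {K : Type*} [Field K] [Algebra ℚ K] (σ : K ≃ₐ[ℚ] K) :
    AddMonoidAlgebra ℤ K →+* AddMonoidAlgebra ℤ K :=
  AddMonoidAlgebra.mapDomainRingHom ℤ (σ : K →+ K)

theorem galoisMap_galoisMap {K : Type*} [Field K] [Algebra ℚ K] (σ τ : K ≃ₐ[ℚ] K)
    (x : AddMonoidAlgebra ℤ K) : galoisMap σ (galoisMap τ x) = galoisMap (σ * τ) x := by
  induction x using AddMonoidAlgebra.induction_linear with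
  | zero => simp
  | add f g hf hg => simp only [map_add, hf, hg]
  | single v m => simp

theorem coeff_galoisMap {K : Type*} [Field K] [Algebra ℚ K] (σ : K ≃ₐ[ℚ] K)
    (x : AddMonoidAlgebra ℤ K) (v : K) : (galoisMap σ x).coeff (σ v) = x.coeff v :=
  Finsupp.mapDomain_apply σ.injective x.coeff v

/-- The exponentials of distinct elements of a Galois number field are linearly independent
over `ℤ`. -/
theorem expAlgHom_ne_zero {K : Type*} [Field K] [NumberField K] [IsGalois ℚ K]
    (φ : K →+* ℂ) {y : AddMonoidAlgebra ℤ K} (hy : y ≠ 0) : expAlgHom φ y ≠ 0 := by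
  classical
  intro hexp
  set x := ∏ σ : K ≃ₐ[ℚ] K, galoisMap σ y with hx
  have hx0 : x ≠ 0 := Finset.prod_ne_zero_iff.mpr fun σ _ ↦
    (map_ne_zero_iff _ (AddMonoidAlgebra.mapDomain_injective σ.injective)).mpr hy
  have hxfix (τ : K ≃ₐ[ℚ] K) : galoisMap τ x = x := by
    simp only [hx, map_prod, galoisMap_galoisMap]
    exact Fintype.prod_equiv (Equiv.mulLeft τ) _ _ fun _ ↦ rfl
  have hxexp : expAlgHom φ x = 0 := by
    rw [hx, map_prod]
    refine Finset.prod_eq_zero (Finset.mem_univ 1) ?_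
    rw [← hexp]
    congr 1
    ext v
    exact coeff_galoisMap 1 y v
  obtain ⟨v, hv⟩ : ∃ v, x.coeff v ≠ 0 := by
    by_contra! h
    exact hx0 (AddMonoidAlgebra.ext (Finsupp.ext h))
  set w : AddMonoidAlgebra ℤ K := ∑ σ : K ≃ₐ[ℚ] K, AddMonoidAlgebra.single (-σ v) 1 with hw
  have hwfix (τ : K ≃ₐ[ℚ] K) : galoisMap τ w = w := by
    simp only [hw, map_sum]
    exact Fintype.sum_equiv (Equiv.mulLeft τ) _ _ fun _ ↦ by simp
  refine sum_mul_exp_ne_zero_of_invariant φ (x * w).coeff (fun σ u ↦ ?_) ?_ ?_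
  · conv_lhs => rw [← hxfix σ, ← hwfix σ, ← map_mul]
    exact coeff_galoisMap σ (x * w) u
  · have hcoeff (σ : K ≃ₐ[ℚ] K) :
        (x * AddMonoidAlgebra.single (-σ v) 1).coeff 0 = x.coeff v := by
      rw [AddMonoidAlgebra.coeff_mul_single_apply, mul_one, neg_neg, zero_add]
      conv_lhs => rw [← hxfix σ]
      exact coeff_galoisMap σ x v
    rw [hw, Finset.mul_sum, AddMonoidAlgebra.coeff_sum, Finsupp.finsetSum_apply]
    simp [hcoeff, hv]
  · rw [← expAlgHom_apply, map_mul, hxexp, zero_mul]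

open Polynomial IntermediateField in
/-- The Hermite–Lindemann theorem. -/
theorem transcendental_exp {α : ℂ} (hα0 : α ≠ 0) (hα : IsAlgebraic ℚ α) :
    Transcendental ℚ (exp α) := by
  intro hexp
  obtain ⟨q, hq0, hq⟩ := (IsFractionRing.isAlgebraic_iff ℤ ℚ ℂ).mpr hexp
  let P := minpoly ℚ α
  let K := adjoin ℚ (P.rootSet ℂ)
  have : P.IsSplittingField ℚ K := adjoin_rootSet_isSplittingField (IsAlgClosed.splits _)
  have : IsGalois ℚ K := .of_separable_splitting_field (minpoly.irreducible hα.isIntegral).separable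
  have : FiniteDimensional ℚ K := IsSplittingField.finiteDimensional K P
  have : NumberField K := {}
  let β : K := ⟨α, subset_adjoin ℚ _ (mem_rootSet.mpr
    ⟨minpoly.ne_zero hα.isIntegral, minpoly.aeval ℚ α⟩)⟩
  have hβ0 : β ≠ 0 := fun h ↦ hα0 (congrArg Subtype.val h)
  have hinj : Function.Injective (multiplesHom K β) := fun m n h ↦ by simpa [hβ0] using h
  let ψ := AddMonoidAlgebra.mapDomainRingHom ℤ (multiplesHom K β)
  have hψ : ((expAlgHom (algebraMap K ℂ)).toRingHom.comp ψ).comp (toFinsuppIso ℤ).toRingHom =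
      (aeval (exp α)).toRingHom := by
    refine Polynomial.ringHom_ext (by simp) ?_
    simp [ψ, expAlgHom_single, β, toFinsupp_X]
  refine expAlgHom_ne_zero (algebraMap K ℂ) (y := ψ q.toFinsupp) ?_
    ((RingHom.congr_fun hψ q).trans hq)
  exact (map_ne_zero_iff _ (AddMonoidAlgebra.mapDomain_injective hinj)).mpr
    (by simpa using hq0)

/-- A transcendental number is not a root of a nonzero polynomial of degree at most two with
algebraic coefficients. -/
theorem coeffs_eq_zero_of_transcendental {w u r v : ℂ} (hw : Transcendental ℚ w)
    (hu : IsAlgebraic ℚ u) (hr : IsAlgebraic ℚ r) (hv : IsAlgebraic ℚ v)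
    (h : u * w ^ 2 + r * w + v = 0) : u = 0 ∧ r = 0 ∧ v = 0 := by
  have hnum (n : ℕ) : IsAlgebraic ℚ (n : ℂ) := isAlgebraic_natCast n
  have key {s t : ℂ} (hs : IsAlgebraic ℚ s) (ht : IsAlgebraic ℚ t)
      (h : IsAlgebraic ℚ (s * w + t)) : s = 0 := by
    by_contra hs0
    refine hw ?_
    have : w = s⁻¹ * (s * w + t - t) := by field_simp; ring
    rw [this]
    exact hs.inv.mul (h.sub ht)
  have hu0 : u = 0 := by
    have : IsAlgebraic ℚ (((2 : ℕ) * u * w + r) ^ 2) := by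
      have : ((2 : ℕ) * u * w + r) ^ 2 = r ^ 2 - (4 : ℕ) * u * v := by
        push_cast
        linear_combination 4 * u * h
      rw [this]
      exact (hr.pow 2).sub (((hnum 4).mul hu).mul hv)
    simpa using key ((hnum 2).mul hu) hr (this.of_pow two_pos)
  subst hu0
  have h' : r * w + v = 0 := by linear_combination h
  have hr0 : r = 0 := key hr hv (h' ▸ isAlgebraic_zero)
  subst hr0
  exact ⟨rfl, rfl, by simpa using h'⟩

theorem eq_zero_of_mul_cos_add_mul_sin_add_eq_zero {x p q r : ℂ} (hx0 : x ≠ 0)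
    (hx : IsAlgebraic ℚ x) (hp : IsAlgebraic ℚ p) (hq : IsAlgebraic ℚ q) (hr : IsAlgebraic ℚ r)
    (h : p * cos x + q * sin x + r = 0) : p = 0 ∧ q = 0 ∧ r = 0 := by
  have hI : IsAlgebraic ℚ I := .of_pow two_pos (by rw [I_sq]; exact isAlgebraic_one.neg)
  have hw := transcendental_exp (mul_ne_zero hx0 I_ne_zero) (hx.mul hI)
  obtain ⟨h1, h2, h3⟩ := coeffs_eq_zero_of_transcendental hw (hp.sub (hq.mul hI))
    ((isAlgebraic_natCast 2).mul hr) (hp.add (hq.mul hI)) (by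
      have hexp : exp (-x * I) * exp (x * I) = 1 := by rw [← exp_add]; simp
      rw [cos, sin] at h
      push_cast
      linear_combination (2 * exp (x * I)) * h - (p + q * I) * hexp)
  have hp0 : p = 0 := by linear_combination (h1 + h3) / 2
  exact ⟨hp0, by simpa [hp0] using h3, by simpa using h2⟩

/-- If `F(z) = ∫₀ᵃ e^{izt} Ψ(t) dt` (with `a > 0` algebraic, `Ψ` a polynomial with
algebraic coefficients) vanishes at a nonzero algebraic `z₀`, and
`F(z) = P(z)cos(az) + Q(z)sin(az) + R(z)` with `P(z₀), Q(z₀), R(z₀)` algebraic, then with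
`t₀ = tan(a z₀/2)` we have `P(z₀)(1-t₀²) + 2Q(z₀)t₀ + R(z₀)(1+t₀²) = 0`; if not all of
`P(z₀), Q(z₀), R(z₀)` vanish this makes `t₀` algebraic, contradicting transcendence of `tan`
at a nonzero algebraic point; hence `P(z₀) = Q(z₀) = R(z₀) = 0`. -/
theorem stmt7 (a : ℝ) (ha : 0 < a) (haAlg : IsAlgebraic ℚ (a : ℂ))
    (Ψ : Polynomial ℂ) (hΨ : ∀ i : ℕ, IsAlgebraic ℚ (Ψ.coeff i))
    (F : ℂ → ℂ)
    (hF : ∀ z : ℂ, F z = ∫ t in (0:ℝ)..a, Complex.exp (Complex.I * z * t) * Ψ.eval (t : ℂ))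
    (P Q R : ℂ → ℂ)
    (hPQR : ∀ z : ℂ, z ≠ 0 →
      F z = P z * Complex.cos (a * z) + Q z * Complex.sin (a * z) + R z)
    (z₀ : ℂ) (hz₀ : z₀ ≠ 0) (hz₀Alg : IsAlgebraic ℚ z₀) (hFz₀ : F z₀ = 0)
    (hPAlg : IsAlgebraic ℚ (P z₀)) (hQAlg : IsAlgebraic ℚ (Q z₀))
    (hRAlg : IsAlgebraic ℚ (R z₀)) :
    P z₀ * (1 - Complex.tan (a * z₀ / 2) ^ 2) +
        2 * Q z₀ * Complex.tan (a * z₀ / 2) +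
        R z₀ * (1 + Complex.tan (a * z₀ / 2) ^ 2) = 0 ∧
    ((P z₀ ≠ 0 ∨ Q z₀ ≠ 0 ∨ R z₀ ≠ 0) → IsAlgebraic ℚ (Complex.tan (a * z₀ / 2))) ∧
    (P z₀ = 0 ∧ Q z₀ = 0 ∧ R z₀ = 0) := by
  have h : P z₀ = 0 ∧ Q z₀ = 0 ∧ R z₀ = 0 :=
    eq_zero_of_mul_cos_add_mul_sin_add_eq_zero
      (mul_ne_zero (ofReal_ne_zero.mpr ha.ne') hz₀) (haAlg.mul hz₀Alg) hPAlg hQAlg hRAlg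
      ((hPQR z₀ hz₀).symm.trans hFz₀)
  obtain ⟨hP, hQ, hR⟩ := h
  simp [hP, hQ, hR]
end

section
/- (Titchmarsh convolution theorem, special case) If f, g ∈ L¹(0,a) and the convolution ∫₀ˣ f(t) g(x-t) dt = 0 for almost every x ∈ (0,a), then there exist α, β ≥ 0 with α + β ≥ a such that f = 0 a.e. on (0,α) and g = 0 a.e. on (0,β). -/
open MeasureTheory Complex intervalIntegral

/-- The Laplace transform over the whole real line, at a real parameter. -/
noncomputable def realLaplace (h : ℝ → ℂ) (l : ℝ) : ℂ := ∫ t, (Real.exp (-(l * t)) : ℂ) * h t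

lemma integrable_exp_mul {h : ℝ → ℂ} (hi : Integrable h) (h0 : ∀ t < 0, h t = 0) {l : ℝ}
    (hl : 0 ≤ l) : Integrable fun t => (Real.exp (-(l * t)) : ℂ) * h t := by
  refine hi.mono (by have := hi.aestronglyMeasurable; fun_prop) (.of_forall fun t => ?_)
  rcases lt_or_ge t 0 with ht | ht
  · simp [h0 t ht]
  · rw [norm_mul, Complex.norm_real, Real.norm_eq_abs, Real.abs_exp]
    exact mul_le_of_le_one_left (norm_nonneg _)
      (Real.exp_le_one_iff.2 (neg_nonpos.2 (mul_nonneg hl ht)))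

lemma norm_realLaplace_le {h : ℝ → ℂ} (hi : Integrable h) {c l : ℝ}
    (h0 : ∀ᵐ t, t < c → h t = 0) (hl : 0 ≤ l) :
    ‖realLaplace h l‖ ≤ (∫ t, ‖h t‖) * Real.exp (-(l * c)) := by
  rw [← MeasureTheory.integral_mul_const]
  refine norm_integral_le_of_norm_le (hi.norm.mul_const _) ?_
  filter_upwards [h0] with t ht
  rcases lt_or_ge t c with htc | htc
  · simp [ht htc]
  · rw [norm_mul, Complex.norm_real, Real.norm_eq_abs, Real.abs_exp, mul_comm]
    gcongr

lemma ae_eq_zero_of_setIntegral_Iic_eq_zero {h : ℝ → ℂ} (hi : Integrable h) {c : ℝ}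
    (hz : ∀ θ < c, ∫ t in Set.Iic θ, h t = 0) : ∀ᵐ t, t < c → h t = 0 := by
  filter_upwards [LocallyIntegrable.ae_hasDerivAt_integral hi.locallyIntegrable] with x hx hxc
  refine (hx (c - 1)).unique ?_
  refine (hasDerivAt_const x (0 : ℂ)).congr_of_eventuallyEq ?_
  filter_upwards [Iio_mem_nhds hxc] with y hy
  rw [← integral_Iic_sub_Iic hi.integrableOn hi.integrableOn, hz y hy, hz _ (by linarith), sub_zero]

lemma hasSum_exp_sub_one (y : ℂ) :
    HasSum (fun k : ℕ => y ^ (k + 1) / ((k + 1).factorial : ℂ)) (Complex.exp y - 1) := by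
  have := (hasSum_nat_add_iff' 1).2 (NormedSpace.expSeries_div_hasSum_exp y)
  simpa [← Complex.exp_eq_exp_ℂ] using this

lemma hasSum_exp_sub_one_real (y : ℝ) :
    HasSum (fun k : ℕ => y ^ (k + 1) / ((k + 1).factorial : ℝ)) (Real.exp y - 1) := by
  have := (hasSum_nat_add_iff' 1).2 (NormedSpace.expSeries_div_hasSum_exp y)
  simpa [← Real.exp_eq_exp_ℝ] using this

/-- A Laplace transform evaluated against an exponential series in the parameter. -/
lemma hasSum_realLaplace {h : ℝ → ℂ} (hi : Integrable h) (h0 : ∀ t < 0, h t = 0) {l : ℝ}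
    (hl : 0 ≤ l) (θ : ℝ) :
    HasSum (fun k : ℕ => (-Real.exp (l * θ) : ℂ) ^ (k + 1) / ((k + 1).factorial : ℂ) *
        realLaplace h ((k + 1 : ℕ) * l))
      (∫ t, (Complex.exp (-Real.exp (l * (θ - t))) - 1) * h t) := by
  have hk (k : ℕ) : (0 : ℝ) ≤ (k + 1 : ℕ) * l := by positivity
  have key := hasSum_integral_of_summable_integral_norm (μ := volume)
    (F := fun (k : ℕ) t => (-Real.exp (l * θ) : ℂ) ^ (k + 1) / ((k + 1).factorial : ℂ) *
      ((Real.exp (-((k + 1 : ℕ) * l * t)) : ℂ) * h t))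
    (fun k => (integrable_exp_mul hi h0 (hk k)).const_mul _) ?_
  · convert key using 1
    · rfl
    · funext k
      rw [MeasureTheory.integral_const_mul, realLaplace]
    · refine MeasureTheory.integral_congr_ae (.of_forall fun t => ?_)
      have := (hasSum_exp_sub_one (-Real.exp (l * (θ - t)))).mul_right (h t)
      refine this.tsum_eq.symm.trans (tsum_congr fun k => ?_)
      have e : Real.exp (l * (θ - t)) ^ (k + 1)
          = Real.exp (l * θ) ^ (k + 1) * Real.exp (-((k + 1 : ℕ) * l * t)) := by
        rw [← Real.exp_nat_mul, ← Real.exp_nat_mul, ← Real.exp_add]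
        congr 1; push_cast; ring
      have e' := congrArg (fun r : ℝ => (r : ℂ)) e
      push_cast [-Complex.ofReal_exp] at e' ⊢
      rw [neg_pow, e', neg_pow (Real.exp (l * θ) : ℂ)]
      ring
  · have hs := (hasSum_exp_sub_one_real (Real.exp (l * θ))).summable.mul_right (∫ t, ‖h t‖)
    refine hs.of_nonneg_of_le (fun k => integral_nonneg fun t => norm_nonneg _) fun k => ?_
    rw [← MeasureTheory.integral_const_mul]
    refine integral_mono_of_nonneg (.of_forall fun t => norm_nonneg _) (hi.norm.const_mul _)
      (.of_forall fun t => ?_)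
    simp only [norm_mul, norm_div, norm_pow, norm_neg, Complex.norm_real, Real.norm_eq_abs,
      Real.abs_exp, Complex.norm_natCast]
    refine mul_le_mul_of_nonneg_left ?_ (by positivity)
    rcases lt_or_ge t 0 with ht | ht
    · simp [h0 t ht]
    · exact mul_le_of_le_one_left (norm_nonneg _)
        (Real.exp_le_one_iff.2 (neg_nonpos.2 (mul_nonneg (hk k) ht)))

/-- Phragmén's lemma: exponential decay of the Laplace transform bounds the support below. -/
lemma ae_eq_zero_of_norm_realLaplace_le {h : ℝ → ℂ} (hi : Integrable h) (h0 : ∀ t < 0, h t = 0)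
    {c C : ℝ} (hb : ∀ l, 0 ≤ l → ‖realLaplace h l‖ ≤ C * Real.exp (-(l * c))) :
    ∀ᵐ t, t < c → h t = 0 := by
  refine ae_eq_zero_of_setIntegral_Iic_eq_zero hi fun θ hθ => ?_
  have lim₁ : Filter.Tendsto
      (fun n : ℕ => ∫ t, (Complex.exp (-Real.exp (n * (θ - t))) - 1) * h t) Filter.atTop
      (nhds 0) := by
    have hq : Filter.Tendsto (fun n : ℕ => C * (Real.exp (Real.exp (n * (θ - c))) - 1))
        Filter.atTop (nhds 0) := by
      have h1 : Filter.Tendsto (fun n : ℕ => Real.exp (n * (θ - c))) Filter.atTop (nhds 0) :=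
        Real.tendsto_exp_atBot.comp
          (tendsto_natCast_atTop_atTop.atTop_mul_const_of_neg (by linarith))
      simpa using (((Real.continuous_exp.tendsto 0).comp h1).sub_const 1).const_mul C
    refine squeeze_zero_norm (fun n => ?_) hq
    rw [← (hasSum_realLaplace hi h0 n.cast_nonneg θ).tsum_eq]
    refine tsum_of_norm_bounded ((hasSum_exp_sub_one_real _).mul_left C) fun k => ?_
    simp only [norm_mul, norm_div, norm_pow, norm_neg, Complex.norm_real, Real.norm_eq_abs,
      Real.abs_exp, Complex.norm_natCast]
    have e : Real.exp (n * (θ - c)) ^ (k + 1)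
        = Real.exp (n * θ) ^ (k + 1) * Real.exp (-((k + 1 : ℕ) * n * c)) := by
      rw [← Real.exp_nat_mul, ← Real.exp_nat_mul, ← Real.exp_add]
      congr 1; push_cast; ring
    rw [e]
    calc _ ≤ Real.exp (n * θ) ^ (k + 1) / ((k + 1).factorial : ℝ) *
          (C * Real.exp (-((k + 1 : ℕ) * n * c))) := by
          gcongr
          exact hb _ (by positivity)
      _ = _ := by ring
  have lim₂ : Filter.Tendsto
      (fun n : ℕ => ∫ t, (Complex.exp (-Real.exp (n * (θ - t))) - 1) * h t) Filter.atTop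
      (nhds (∫ t, (Set.Iic θ).indicator (fun t => -h t) t)) := by
    refine tendsto_integral_of_dominated_convergence (fun t => ‖h t‖)
      (fun n => by have := hi.aestronglyMeasurable; fun_prop) hi.norm
      (fun n => .of_forall fun t => ?_) ?_
    · rw [norm_mul]
      refine mul_le_of_le_one_left (norm_nonneg _) ?_
      rw [← Complex.ofReal_neg, ← Complex.ofReal_exp, ← Complex.ofReal_one, ← Complex.ofReal_sub,
        Complex.norm_real, Real.norm_eq_abs, abs_le]
      have h1 := Real.exp_pos (-Real.exp (n * (θ - t)))
      have h2 : Real.exp (-Real.exp (n * (θ - t))) ≤ 1 :=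
        Real.exp_le_one_iff.2 (neg_nonpos.2 (Real.exp_pos _).le)
      constructor <;> linarith
    · have hne : ∀ᵐ t : ℝ, t ≠ θ := by simp [ae_iff]
      filter_upwards [hne] with t ht
      rcases lt_or_gt_of_ne ht with ht | ht
      · have h1 : Filter.Tendsto (fun n : ℕ => Real.exp (-Real.exp (n * (θ - t)))) Filter.atTop
            (nhds 0) :=
          Real.tendsto_exp_neg_atTop_nhds_zero.comp (Real.tendsto_exp_atTop.comp
            (tendsto_natCast_atTop_atTop.atTop_mul_const (by linarith)))
        have h2 := (((Complex.continuous_ofReal.tendsto _).comp h1).sub_const 1).mul_const (h t)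
        simpa [Set.indicator, ht.le, Function.comp_def] using h2
      · have h1 : Filter.Tendsto (fun n : ℕ => Real.exp (n * (θ - t))) Filter.atTop (nhds 0) :=
          Real.tendsto_exp_atBot.comp
            (tendsto_natCast_atTop_atTop.atTop_mul_const_of_neg (by linarith))
        have h2 : Filter.Tendsto (fun n : ℕ => Real.exp (-Real.exp (n * (θ - t)))) Filter.atTop
            (nhds 1) := by
          simpa [Function.comp_def] using (Real.continuous_exp.tendsto _).comp h1.neg
        have h3 := (((Complex.continuous_ofReal.tendsto _).comp h2).sub_const 1).mul_const (h t)
        simpa [Set.indicator, ht.not_ge, Function.comp_def] using h3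
  have := tendsto_nhds_unique lim₂ lim₁
  rw [MeasureTheory.integral_indicator measurableSet_Iic, MeasureTheory.integral_neg,
    neg_eq_zero] at this
  exact this

/-- `F l = O(exp (-l x))` on the nonnegative half-line. -/
def ExpDecay (x : ℝ) (F : ℝ → ℂ) : Prop := ∃ C, ∀ l, 0 ≤ l → ‖F l‖ ≤ C * Real.exp (-(l * x))

namespace ExpDecay

variable {x y : ℝ} {F G : ℝ → ℂ}

lemma mono (hF : ExpDecay x F) (hyx : y ≤ x) : ExpDecay y F := by
  obtain ⟨C, hC⟩ := hF
  have hC0 : 0 ≤ C := by simpa using (norm_nonneg _).trans (hC 0 le_rfl)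
  refine ⟨C, fun l hl => (hC l hl).trans ?_⟩
  gcongr

lemma sub (hF : ExpDecay x F) (hG : ExpDecay x G) : ExpDecay x fun l => F l - G l := by
  obtain ⟨C, hC⟩ := hF
  obtain ⟨D, hD⟩ := hG
  refine ⟨C + D, fun l hl => (norm_sub_le _ _).trans ?_⟩
  rw [add_mul]
  exact add_le_add (hC l hl) (hD l hl)

lemma mul (hF : ExpDecay x F) (hG : ExpDecay y G) : ExpDecay (x + y) fun l => F l * G l := by
  obtain ⟨C, hC⟩ := hF
  obtain ⟨D, hD⟩ := hG
  refine ⟨C * D, fun l hl => ?_⟩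
  rw [norm_mul, mul_add, neg_add, Real.exp_add, mul_mul_mul_comm]
  exact mul_le_mul (hC l hl) (hD l hl) (norm_nonneg _) ((norm_nonneg _).trans (hC l hl))

lemma of_sq (hF : ExpDecay (x + x) fun l => F l ^ 2) : ExpDecay x F := by
  obtain ⟨C, hC⟩ := hF
  have hC0 : 0 ≤ C := by simpa using (norm_nonneg _).trans (hC 0 le_rfl)
  refine ⟨√C, fun l hl => ?_⟩
  refine le_of_sq_le_sq ?_ (by positivity)
  rw [mul_pow, Real.sq_sqrt hC0, ← norm_pow, ← Real.exp_nat_mul]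
  have e : ((2 : ℕ) : ℝ) * -(l * x) = -(l * (x + x)) := by push_cast; ring
  rw [e]
  exact hC l hl

end ExpDecay

/-- An integrable function on the line supported in `[0, a]`. -/
structure IntegrableSuppIcc (a : ℝ) (f : ℝ → ℂ) : Prop where
  integrable : Integrable f
  eq_zero : ∀ t ∉ Set.Icc 0 a, f t = 0

/-- The function `t ↦ t ^ m * f t`. -/
def powMul (m : ℕ) (f : ℝ → ℂ) (t : ℝ) : ℂ := (t : ℂ) ^ m * f t

lemma IntegrableSuppIcc.eq_zero_of_neg {a : ℝ} {f : ℝ → ℂ} (hf : IntegrableSuppIcc a f) (t : ℝ)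
    (ht : t < 0) : f t = 0 := hf.eq_zero t fun h => ht.not_ge h.1

lemma IntegrableSuppIcc.powMul {a : ℝ} {f : ℝ → ℂ} (hf : IntegrableSuppIcc a f) (m : ℕ) :
    IntegrableSuppIcc a (powMul m f) := by
  refine ⟨(hf.integrable.norm.const_mul (a ^ m)).mono' ?_ (.of_forall fun t => ?_), fun t ht => ?_⟩
  · have := hf.integrable.aestronglyMeasurable
    unfold _root_.powMul
    fun_prop
  · by_cases ht : t ∈ Set.Icc 0 a
    · rw [_root_.powMul, norm_mul, norm_pow, Complex.norm_real, Real.norm_of_nonneg ht.1]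
      have := ht.1
      gcongr
      exact ht.2
    · simp [_root_.powMul, hf.eq_zero t ht]
  · simp [_root_.powMul, hf.eq_zero t ht]

/-- Convolution of complex-valued functions on the line. -/
noncomputable def lineConv (u v : ℝ → ℂ) : ℝ → ℂ :=
  convolution u v (ContinuousLinearMap.mul ℝ ℂ) volume

lemma lineConv_apply (u v : ℝ → ℂ) (x : ℝ) : lineConv u v x = ∫ t, u t * v (x - t) := rfl

section lineConv

variable {a : ℝ} {u v : ℝ → ℂ}

lemma lineConv_eq_zero_of_neg (hu : ∀ t < 0, u t = 0) (hv : ∀ t < 0, v t = 0) (x : ℝ)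
    (hx : x < 0) : lineConv u v x = 0 := by
  rw [lineConv_apply]
  refine integral_eq_zero_of_ae (.of_forall fun t => ?_)
  rcases lt_or_ge t 0 with ht | ht
  · simp [hu t ht]
  · simp [hv (x - t) (by linarith)]

lemma integrable_lineConv (hu : Integrable u) (hv : Integrable v) : Integrable (lineConv u v) :=
  hu.integrable_convolution _ hv

lemma realLaplace_lineConv (hu : Integrable u) (hv : Integrable v) (hu0 : ∀ t < 0, u t = 0)
    (hv0 : ∀ t < 0, v t = 0) {l : ℝ} (hl : 0 ≤ l) :
    realLaplace (lineConv u v) l = realLaplace u l * realLaplace v l := by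
  have key := integral_convolution (ContinuousLinearMap.mul ℝ ℂ) (μ := volume) (ν := volume)
    (integrable_exp_mul hu hu0 hl) (integrable_exp_mul hv hv0 hl)
  rw [ContinuousLinearMap.mul_apply'] at key
  rw [realLaplace, realLaplace, realLaplace, ← key]
  congr 1 with x
  rw [lineConv_apply, convolution_def, ← MeasureTheory.integral_const_mul]
  congr 1 with t
  have : Real.exp (-(l * x)) = Real.exp (-(l * t)) * Real.exp (-(l * (x - t))) := by
    rw [← Real.exp_add]; congr 1; ring
  rw [ContinuousLinearMap.mul_apply', this]
  push_cast
  ring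

lemma ae_mul_lineConv (hu : IntegrableSuppIcc a u) (hv : IntegrableSuppIcc a v) :
    ∀ᵐ x : ℝ, x * lineConv u v x = lineConv (powMul 1 u) v x + lineConv u (powMul 1 v) x := by
  filter_upwards [(hu.powMul 1).integrable.ae_convolution_exists (.mul ℝ ℂ) hv.integrable,
    hu.integrable.ae_convolution_exists (.mul ℝ ℂ) (hv.powMul 1).integrable] with x h1 h2
  rw [lineConv_apply, lineConv_apply, lineConv_apply, ← MeasureTheory.integral_const_mul]
  refine Eq.trans ?_ (MeasureTheory.integral_add h1 h2)
  congr 1 with t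
  simp only [powMul]
  push_cast
  ring

lemma expDecay_mul_iff (hu : IntegrableSuppIcc a u) (hv : IntegrableSuppIcc a v) {x : ℝ} :
    ExpDecay x (fun l => realLaplace u l * realLaplace v l) ↔
      ∀ᵐ t, t < x → lineConv u v t = 0 := by
  have hL := fun l => realLaplace_lineConv hu.integrable hv.integrable hu.eq_zero_of_neg
    hv.eq_zero_of_neg (l := l)
  have hi := integrable_lineConv hu.integrable hv.integrable
  constructor
  · rintro ⟨C, hC⟩
    refine ae_eq_zero_of_norm_realLaplace_le (C := C) hi
      (lineConv_eq_zero_of_neg hu.eq_zero_of_neg hv.eq_zero_of_neg) fun l hl => ?_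
    rw [hL l hl]
    exact hC l hl
  · intro h
    refine ⟨∫ t, ‖lineConv u v t‖, fun l hl => ?_⟩
    beta_reduce
    rw [← hL l hl]
    exact norm_realLaplace_le hi h hl

lemma ExpDecay.deriv_mul (hu : IntegrableSuppIcc a u) (hv : IntegrableSuppIcc a v) {x : ℝ}
    (h : ExpDecay x fun l => realLaplace u l * realLaplace v l) :
    ExpDecay x fun l => realLaplace (powMul 1 u) l * realLaplace v l +
      realLaplace u l * realLaplace (powMul 1 v) l := by
  have hu1 := hu.powMul 1
  have hv1 := hv.powMul 1
  have i1 := integrable_lineConv hu1.integrable hv.integrable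
  have i2 := integrable_lineConv hu.integrable hv1.integrable
  refine ⟨∫ t, ‖(lineConv (powMul 1 u) v + lineConv u (powMul 1 v)) t‖, fun l hl => ?_⟩
  have e : realLaplace (powMul 1 u) l * realLaplace v l +
      realLaplace u l * realLaplace (powMul 1 v) l
      = realLaplace (lineConv (powMul 1 u) v + lineConv u (powMul 1 v)) l := by
    rw [← realLaplace_lineConv hu1.integrable hv.integrable hu1.eq_zero_of_neg
      hv.eq_zero_of_neg hl, ← realLaplace_lineConv hu.integrable hv1.integrable
      hu.eq_zero_of_neg hv1.eq_zero_of_neg hl]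
    refine (MeasureTheory.integral_add
      (integrable_exp_mul i1 (lineConv_eq_zero_of_neg hu1.eq_zero_of_neg hv.eq_zero_of_neg) hl)
      (integrable_exp_mul i2
        (lineConv_eq_zero_of_neg hu.eq_zero_of_neg hv1.eq_zero_of_neg) hl)).symm.trans ?_
    simp [realLaplace, mul_add]
  beta_reduce
  rw [e]
  refine norm_realLaplace_le (i1.add i2) (c := x) ?_ hl
  filter_upwards [(expDecay_mul_iff hu hv).1 h, ae_mul_lineConv hu hv] with t ht1 ht2 htx
  rw [Pi.add_apply, ← ht2, ht1 htx, mul_zero]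

end lineConv

/-- A nonnegative sequence whose next value is at least the average of the current value and the
smaller of the next two does not drop. -/
lemma le_succ_of_average_le {s : ℕ → ℝ} (h0 : ∀ k, 0 ≤ s k)
    (hs : ∀ k, s k + min (s (k + 1)) (s (k + 2)) ≤ 2 * s (k + 1)) (k : ℕ) : s k ≤ s (k + 1) := by
  by_contra! hlt
  set d := s k - s (k + 1) with hd
  have step (j : ℕ) : d ≤ s (k + j) - s (k + j + 1) := by
    induction j with
    | zero => exact le_rfl
    | succ j ih =>
      have := hs (k + j)
      rcases min_cases (s (k + j + 1)) (s (k + j + 2)) with ⟨h, -⟩ | ⟨h, -⟩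
      · linarith
      · rw [show k + (j + 1) = k + j + 1 by ring]
        linarith
  have total (j : ℕ) : s (k + j) ≤ s k - j * d := by
    induction j with
    | zero => simp
    | succ j ih =>
      have := step j
      rw [← add_assoc]
      push_cast
      linarith
  obtain ⟨j, hj⟩ := exists_nat_gt (s k / d)
  have := total j
  have := h0 (k + j)
  rw [div_lt_iff₀ (by linarith)] at hj
  linarith

lemma forall_lt_of_average {Q : ℕ → ℝ → Prop} {c : ℝ} (hc : 0 ≤ c) (h0 : ∀ k, Q k 0)
    (hanti : ∀ k x y, Q k x → y ≤ x → Q k y) (hQ0 : Q 0 c)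
    (hQ : ∀ k x y, Q k x → Q (k + 1) y → Q (k + 2) y → Q (k + 1) ((x + y) / 2)) (k : ℕ) :
    ∀ x < c, Q k x := by
  let S (k : ℕ) : Set ℝ := {x | x ≤ c ∧ Q k x}
  have hbdd (k) : BddAbove (S k) := ⟨c, fun x hx => hx.1⟩
  have hlt (k x) (hx : x < sSup (S k)) : Q k x := by
    obtain ⟨y, hy, hxy⟩ := exists_lt_of_lt_csSup (s := S k) ⟨0, hc, h0 k⟩ hx
    exact hanti k y x hy.2 hxy.le
  have hle (k) : sSup (S k) ≤ c := csSup_le ⟨0, hc, h0 k⟩ fun x hx => hx.1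
  have hmono := le_succ_of_average_le (s := fun k => sSup (S k))
    (fun k => le_csSup (hbdd k) ⟨hc, h0 k⟩) fun k => by
      refine le_of_forall_pos_le_add fun ε hε => ?_
      have h1 := min_le_left (sSup (S (k + 1))) (sSup (S (k + 2)))
      have h2 := min_le_right (sSup (S (k + 1))) (sSup (S (k + 2)))
      set μ := min (sSup (S (k + 1))) (sSup (S (k + 2)))
      have h3 := hQ k (sSup (S k) - ε / 2) (μ - ε / 2) (hlt k _ (by linarith))
        (hlt _ _ (by linarith)) (hlt _ _ (by linarith))
      have h4 := le_csSup (hbdd (k + 1)) (a := (sSup (S k) - ε / 2 + (μ - ε / 2)) / 2)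
        ⟨by linarith [hle k, hle (k + 1)], h3⟩
      linarith
  have hge : c ≤ sSup (S k) :=
    (le_csSup (hbdd 0) ⟨le_rfl, hQ0⟩).trans (monotone_nat_of_le_succ hmono k.zero_le)
  exact fun x hx => hlt k x (hx.trans_le hge)

lemma powMul_one_powMul (m : ℕ) (f : ℝ → ℂ) : powMul 1 (powMul m f) = powMul (m + 1) f := by
  funext t
  simp only [powMul]
  ring

lemma ae_lt_imp_of_forall_lt {p : ℝ → Prop} {c : ℝ} (h : ∀ x < c, ∀ᵐ t : ℝ, t < x → p t) :
    ∀ᵐ t : ℝ, t < c → p t := by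
  obtain ⟨w, -, hw, hlim⟩ := exists_seq_strictMono_tendsto c
  filter_upwards [ae_all_iff.2 fun n => h (w n) (hw n)] with t ht htc
  obtain ⟨n, hn⟩ := (hlim.eventually (lt_mem_nhds htc)).exists
  exact ht n hn

/-- If `f * g` vanishes on `(-∞, c)`, so does `f * (t ^ n g)` for every `n`. -/
lemma lineConv_powMul_ae_eq_zero {a c : ℝ} (hc : 0 ≤ c) {f g : ℝ → ℂ}
    (hf : IntegrableSuppIcc a f) (hg : IntegrableSuppIcc a g)
    (h : ∀ᵐ t, t < c → lineConv f g t = 0) (n : ℕ) :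
    ∀ᵐ t, t < c → lineConv f (powMul n g) t = 0 := by
  have p0 (u : ℝ → ℂ) : powMul 0 u = u := by funext t; simp [powMul]
  set F := fun m => realLaplace (powMul m f)
  set G := fun m => realLaplace (powMul m g)
  let P (m n : ℕ) (x : ℝ) : Prop := ExpDecay x fun l => F m l * G n l
  have hderiv {m n x} (hP : P m n x) :
      ExpDecay x fun l => F (m + 1) l * G n l + F m l * G (n + 1) l := by
    simpa only [powMul_one_powMul] using ExpDecay.deriv_mul (hf.powMul m) (hg.powMul n) hP
  have right {m n x y} (h1 : P m n x) (h2 : P m (n + 1) y) (h3 : P (m + 1) (n + 1) y) :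
      P m (n + 1) ((x + y) / 2) := by
    refine ExpDecay.of_sq ?_
    rw [add_halves]
    convert ((hderiv h1).mul h2).sub (h1.mul h3) using 2
    ring
  have left {m n x y} (h1 : P m n x) (h2 : P (m + 1) n y) (h3 : P (m + 1) (n + 1) y) :
      P (m + 1) n ((x + y) / 2) := by
    refine ExpDecay.of_sq ?_
    rw [add_halves]
    convert ((hderiv h1).mul h2).sub (h1.mul h3) using 2
    ring
  refine ae_lt_imp_of_forall_lt fun x hx => ?_
  have key := forall_lt_of_average (Q := fun k x => ∀ m n, m + n = k → P m n x) hc ?_ ?_ ?_ ?_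
    n x hx 0 n (zero_add n)
  · have := (expDecay_mul_iff (hf.powMul 0) (hg.powMul n)).1 key
    rwa [p0] at this
  · intro _ m n _
    refine (expDecay_mul_iff (hf.powMul m) (hg.powMul n)).2 (.of_forall ?_)
    exact lineConv_eq_zero_of_neg (hf.powMul m).eq_zero_of_neg (hg.powMul n).eq_zero_of_neg
  · exact fun k x y hP hyx m n hmn => (hP m n hmn).mono hyx
  · intro m n hmn
    obtain ⟨rfl, rfl⟩ : m = 0 ∧ n = 0 := by omega
    refine (expDecay_mul_iff (hf.powMul 0) (hg.powMul 0)).2 ?_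
    rwa [p0, p0]
  · intro k x y h1 h2 h3 m n hmn
    rcases n with _ | n
    · obtain rfl : m = k + 1 := by omega
      exact left (h1 _ _ rfl) (h2 _ _ rfl) (h3 _ _ (by ring))
    · exact right (h1 _ _ (by omega)) (h2 _ _ hmn) (h3 _ _ (by omega))

/-- A compactly supported integrable function all of whose moments vanish is zero. -/
lemma IntegrableSuppIcc.ae_eq_zero_of_moments {a : ℝ} {w : ℝ → ℂ}
    (hw : IntegrableSuppIcc a w) (hm : ∀ n, ∫ t, _root_.powMul n w t = 0) : ∀ᵐ t, w t = 0 := by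
  have hL (l : ℝ) (hl : 0 ≤ l) : realLaplace w l = 0 := by
    have key := hasSum_integral_of_summable_integral_norm (μ := volume)
      (F := fun (n : ℕ) t => (-l : ℂ) ^ n / (n.factorial : ℂ) * _root_.powMul n w t)
      (fun n => (hw.powMul n).integrable.const_mul _) ?_
    · simp only [MeasureTheory.integral_const_mul, hm, mul_zero] at key
      refine Eq.trans ?_ (key.unique hasSum_zero)
      refine MeasureTheory.integral_congr_ae (.of_forall fun t => ?_)
      have := (NormedSpace.expSeries_div_hasSum_exp (-(l * t) : ℂ)).mul_right (w t)
      rw [← Complex.exp_eq_exp_ℂ] at this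
      dsimp only
      push_cast
      refine this.tsum_eq.symm.trans (tsum_congr fun n => ?_)
      rw [_root_.powMul, ← neg_mul, mul_pow]
      ring
    · have hs := (NormedSpace.expSeries_div_hasSum_exp (l * a : ℝ)).summable.mul_right (∫ t, ‖w t‖)
      refine hs.of_nonneg_of_le (fun k => integral_nonneg fun t => norm_nonneg _) fun k => ?_
      rw [← MeasureTheory.integral_const_mul]
      refine integral_mono_of_nonneg (.of_forall fun t => norm_nonneg _)
        (hw.integrable.norm.const_mul _) (.of_forall fun t => ?_)
      by_cases ht : t ∈ Set.Icc 0 a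
      · simp only [_root_.powMul, norm_mul, norm_div, norm_pow, norm_neg, Complex.norm_real,
          Complex.norm_natCast, Real.norm_of_nonneg hl, Real.norm_of_nonneg ht.1, mul_pow]
        have : t ^ k ≤ a ^ k := pow_le_pow_left₀ ht.1 ht.2 k
        calc _ = l ^ k * t ^ k / k.factorial * ‖w t‖ := by ring
          _ ≤ _ := by gcongr
      · simp [_root_.powMul, hw.eq_zero t ht]
  have h1 (n : ℕ) : ∀ᵐ t : ℝ, t < n → w t = 0 :=
    ae_eq_zero_of_norm_realLaplace_le (C := 0) hw.integrable hw.eq_zero_of_neg fun l hl => by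
      simp [hL l hl]
  filter_upwards [ae_all_iff.2 h1] with t ht
  obtain ⟨n, hn⟩ := exists_nat_gt t
  exact ht n hn

/-- Vanishing of the convolution on `(-∞, c)` forces the product `f s * g t` to vanish for almost
all `s + t < c`. -/
lemma ae_ae_eq_zero_of_lineConv {a c : ℝ} (hc : 0 ≤ c) {f g : ℝ → ℂ}
    (hf : IntegrableSuppIcc a f) (hg : IntegrableSuppIcc a g) (hfm : Measurable f)
    (hgm : Measurable g) (h : ∀ᵐ x, x < c → lineConv f g x = 0) :
    ∀ᵐ t, g t ≠ 0 → ∀ᵐ s, s + t < c → f s = 0 := by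
  have h1 : ∀ᵐ x, ∀ᵐ t, x < c → f (x - t) * g t = 0 := by
    filter_upwards [ae_all_iff.2 (lineConv_powMul_ae_eq_zero hc hf hg h),
      hf.integrable.ae_convolution_exists (.mul ℝ ℂ) hg.integrable] with x hx hex
    by_cases hxc : x < c
    · have hw : IntegrableSuppIcc a fun t => f (x - t) * g t :=
        ⟨by simpa using hex.integrable_swap, fun t ht => by simp [hg.eq_zero t ht]⟩
      have hm (n : ℕ) : ∫ t, powMul n (fun t => f (x - t) * g t) t = 0 := by
        rw [← hx n hxc, lineConv, convolution_eq_swap]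
        congr 1 with t
        simp only [powMul, ContinuousLinearMap.mul_apply']
        ring
      filter_upwards [hw.ae_eq_zero_of_moments hm] with t ht _ using ht
    · exact .of_forall fun t hx => absurd hx hxc
  rw [Measure.ae_ae_comm] at h1
  · filter_upwards [h1] with t ht hgt
    have h2 := (measurePreserving_add_right volume t).quasiMeasurePreserving.ae ht
    filter_upwards [h2] with s hs hst
    simpa [hgt] using hs hst
  · have : Measurable fun p : ℝ × ℝ => f (p.1 - p.2) * g p.2 := by fun_prop
    exact (measurableSet_lt measurable_fst measurable_const).imp
      (this (measurableSet_singleton 0))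

/-- A measurable representative of the extension by zero of a function integrable on `(0, a)`. -/
lemma exists_measurable_indicator_ae_eq {a : ℝ} {f : ℝ → ℂ}
    (hf : IntegrableOn f (Set.Ioo 0 a) volume) :
    ∃ F, IntegrableSuppIcc a F ∧ Measurable F ∧ F =ᵐ[volume] (Set.Ioo 0 a).indicator f := by
  have hi := hf.integrable_indicator measurableSet_Ioo
  have hm := hi.aestronglyMeasurable.stronglyMeasurable_mk.measurable
  have he := hi.aestronglyMeasurable.ae_eq_mk
  set k := hi.aestronglyMeasurable.mk _
  have e : (Set.Ioo 0 a).indicator k =ᵐ[volume] (Set.Ioo 0 a).indicator f := by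
    filter_upwards [he] with t ht
    by_cases hta : t ∈ Set.Ioo 0 a
    · rw [Set.indicator_of_mem hta, ← ht]
    · rw [Set.indicator_of_notMem hta, Set.indicator_of_notMem hta]
  exact ⟨_, ⟨hi.congr e.symm, fun t ht => Set.indicator_of_notMem
    (fun h => ht (Set.Ioo_subset_Icc_self h)) _⟩, hm.indicator measurableSet_Ioo, e⟩

/-- Titchmarsh convolution theorem, special case: if `f, g ∈ L¹(0,a)` and
`∫₀ˣ f(t) g(x-t) dt = 0` for a.e. `x ∈ (0,a)`, then there are `α, β ≥ 0` with `α + β ≥ a`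
such that `f = 0` a.e. on `(0,α)` and `g = 0` a.e. on `(0,β)`. -/
theorem stmt9 (a : ℝ) (ha : 0 < a) (f g : ℝ → ℂ)
    (hf : IntegrableOn f (Set.Ioo 0 a) volume)
    (hg : IntegrableOn g (Set.Ioo 0 a) volume)
    (hconv : ∀ᵐ x ∂(volume.restrict (Set.Ioo 0 a)),
      (∫ t in (0:ℝ)..x, f t * g (x - t)) = 0) :
    ∃ α β : ℝ, 0 ≤ α ∧ 0 ≤ β ∧ a ≤ α + β ∧
      (∀ᵐ x ∂(volume.restrict (Set.Ioo 0 α)), f x = 0) ∧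
      (∀ᵐ x ∂(volume.restrict (Set.Ioo 0 β)), g x = 0) := by
  obtain ⟨F, hF, hFm, hFf⟩ := exists_measurable_indicator_ae_eq hf
  obtain ⟨G, hG, hGm, hGg⟩ := exists_measurable_indicator_ae_eq hg
  have hFG : ∀ᵐ x, x < a → lineConv F G x = 0 := by
    have e : lineConv F G
        = lineConv ((Set.Ioo 0 a).indicator f) ((Set.Ioo 0 a).indicator g) :=
      convolution_congr _ hFf hGg
    rw [e]
    filter_upwards [(ae_restrict_iff' measurableSet_Ioo).1 hconv] with x hx hxa
    have e2 : (fun t => (Set.Ioo 0 a).indicator f t * (Set.Ioo 0 a).indicator g (x - t))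
        = (Set.Ioo 0 x).indicator fun t => f t * g (x - t) := by
      funext t
      by_cases ht : t ∈ Set.Ioo 0 x
      · rw [Set.indicator_of_mem ht, Set.indicator_of_mem
            (show t ∈ Set.Ioo 0 a from ⟨ht.1, ht.2.trans hxa⟩),
          Set.indicator_of_mem
            (show x - t ∈ Set.Ioo 0 a from ⟨sub_pos.2 ht.2, by linarith [ht.1]⟩)]
      · rw [Set.indicator_of_notMem ht]
        by_cases ht0 : 0 < t
        · rw [Set.indicator_of_notMem (s := Set.Ioo 0 a) (a := x - t)
            fun h => ht ⟨ht0, sub_pos.1 h.1⟩, mul_zero]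
        · rw [Set.indicator_of_notMem (s := Set.Ioo 0 a) (a := t) fun h => ht0 h.1, zero_mul]
    rw [lineConv_apply, e2, MeasureTheory.integral_indicator measurableSet_Ioo,
      ← integral_Ioc_eq_integral_Ioo]
    rcases le_or_gt x 0 with hx0 | hx0
    · simp [Set.Ioc_eq_empty hx0.not_gt]
    · rw [← intervalIntegral.integral_of_le hx0.le, hx ⟨hx0, hxa⟩]
  have key := ae_ae_eq_zero_of_lineConv ha.le hF hG hFm hGm hFG
  have back {p P : ℝ → ℂ} {b : ℝ} (hP : P =ᵐ[volume] (Set.Ioo 0 a).indicator p) (hb : b ≤ a)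
      (h : ∀ᵐ t, t < b → P t = 0) : ∀ᵐ x ∂(volume.restrict (Set.Ioo 0 b)), p x = 0 := by
    rw [ae_restrict_iff' measurableSet_Ioo]
    filter_upwards [hP, h] with t h1 h2 ht
    rw [← h2 ht.2, h1, Set.indicator_of_mem (show t ∈ Set.Ioo 0 a from ⟨ht.1, ht.2.trans_le hb⟩)]
  let B : Set ℝ := {b | b ≤ a ∧ ∀ᵐ t, t < b → G t = 0}
  have hB0 : (0 : ℝ) ∈ B := ⟨ha.le, .of_forall hG.eq_zero_of_neg⟩
  have hBb : BddAbove B := ⟨a, fun b hb => hb.1⟩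
  have hβ0 : 0 ≤ sSup B := le_csSup hBb hB0
  have hβa : sSup B ≤ a := csSup_le ⟨0, hB0⟩ fun b hb => hb.1
  refine ⟨a - sSup B, sSup B, by linarith, hβ0, by linarith, back hFf (by linarith) ?_,
    back hGg hβa ?_⟩
  · refine ae_lt_imp_of_forall_lt fun x hx => ?_
    rcases lt_or_ge x 0 with hx0 | hx0
    · exact .of_forall fun t ht => hF.eq_zero_of_neg t (ht.trans hx0)
    have hnot : ¬ ∀ᵐ t, t < a - x → G t = 0 := fun h => by
      have := le_csSup hBb (show a - x ∈ B from ⟨by linarith, h⟩)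
      linarith
    obtain ⟨t, h1, h2⟩ := ((Filter.not_eventually.1 hnot).and_eventually key).exists
    obtain ⟨h3, h4⟩ := Classical.not_imp.1 h1
    filter_upwards [h2 h4] with s hs hsx
    exact hs (by linarith)
  · refine ae_lt_imp_of_forall_lt fun x hx => ?_
    obtain ⟨b, hb, hxb⟩ := exists_lt_of_lt_csSup ⟨0, hB0⟩ hx
    filter_upwards [hb.2] with t ht htx
    exact ht (htx.trans hxb)
end
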